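/- arXiv:1901.04709 — 2 statements merged into one kernel-verified Lean document; each statement's English description precedes it below -/
import Mathlib

section
/- In the ring game G with n >= 3 players and set of colours C with |C| >= n - 1, every scheduler f satisfying f(s, 1) = s_1' (the successor of s_1 in the fixed cyclic order on C) ensures self-stabilization in (3n+1)(n-2)/2 steps: in every improvement path generated by f, every player is selected infinitely often and every joint strategy occurring after the first (3n+1)(n-2)/2 steps is legitimate. -/
/-!
Game-theoretic formalization of Dijkstra's self-stabilization (Apt & Shoja).
Players are `Fin n`; a joint strategy is `s : Fin n → C`.
-/

/-- Payoff in the ring game `G` on the directed ring `0 → 1 → ⋯ → n-1 → 0`: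
player `0` plays the anti-coordination game with respect to its predecessor
(player `n-1`, i.e. `0 - 1` in `Fin n`); every other player `i` plays the
coordination game with respect to its predecessor `i - 1`. -/
def ringPayoff {n : ℕ} [NeZero n] {C : Type*} [DecidableEq C]
    (s : Fin n → C) (i : Fin n) : ℕ :=
  if i = 0 then (if s i = s (i - 1) then 0 else 1)
  else (if s i = s (i - 1) then 1 else 0)

/-- `s i` is a best response of player `i` to the strategies of the others in `s`. -/
def BestResponse {n : ℕ} {C : Type*}
    (p : (Fin n → C) → Fin n → ℕ) (s : Fin n → C) (i : Fin n) : Prop :=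
  ∀ c : C, p (Function.update s i c) i ≤ p s i

/-- An improvement step from `s` to `s'` in which player `i` is selected:
only player `i` changes its strategy and its payoff strictly increases. -/
def StepAt {n : ℕ} {C : Type*}
    (p : (Fin n → C) → Fin n → ℕ) (i : Fin n) (s s' : Fin n → C) : Prop :=
  (∀ j, j ≠ i → s' j = s j) ∧ p s i < p s' i

/-- A joint strategy is legitimate if exactly one player does not play a best response. -/
def Legitimate {n : ℕ} {C : Type*}
    (p : (Fin n → C) → Fin n → ℕ) (s : Fin n → C) : Prop :=
  ∃! i : Fin n, ¬ BestResponse p s i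



/-- Shift that closes the gap at the label `0`. -/
def gapAdj (z : ℤ) : ℤ := if 1 ≤ z then z - 1 else z

/-- Lower bound on the label of the last player. -/
def LastBound {C : Type*} (c : ℤ → C) (h : ℕ → ℤ) (n : ℕ) (d : ℤ) : Prop :=
  h 0 - d ≤ h (n - 1) ∧ (h (n - 1) = h 0 - d → 1 ≤ h 0 ∧ c (h 0 - d) = c (h 0 - 1))

/-- A step of the labelled system. -/
def LabStep {C : Type*} (c : ℤ → C) (n : ℕ) (i : ℕ) (h h' : ℕ → ℤ) : Prop :=
  i < n ∧ (∀ j, j ≠ i → h' j = h j) ∧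
  ((i = 0 ∧ c (h 0) = c (h (n - 1)) ∧ h' 0 = h 0 + 1) ∨
   (0 < i ∧ c (h i) ≠ c (h (i - 1)) ∧ h' i = h (i - 1)))

/-- What non-legitimacy means for labels. -/
def LabBad {C : Type*} (c : ℤ → C) (n : ℕ) (h : ℕ → ℤ) : Prop :=
  (∃ i, 1 ≤ i ∧ i < n - 1 ∧ h (n - 1) < h i ∧ h i < h 0) ∨
  (c (h (n - 1)) = c (h 0) ∧ h (n - 1) < h 0)

/-- Basic invariant. -/
def LabBasic (h : ℕ → ℤ) : Prop :=
  (∀ i, h (i + 1) ≤ h i) ∧ (∀ i : ℕ, -(i : ℤ) ≤ h i)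

/-- Branch: label `0` never copied. -/
def BranchA (n : ℕ) (t : ℕ) (h : ℕ → ℤ) : Prop :=
  (∀ i, 1 ≤ i → h i ≠ 0) ∧
    (t : ℤ) + gapAdj (h 0) ≤ ∑ i ∈ Finset.range n, (gapAdj (h i) + i) + h 0

/-- Branch: some negative label has disappeared. -/
def BranchB {C : Type*} (c : ℤ → C) (n : ℕ) (h : ℕ → ℤ) : Prop :=
  h 0 ≤ n - 2 ∧ ∃ u : ℤ, -((n : ℤ) - 1) ≤ u ∧ u ≤ -1 ∧ (∀ i, 1 ≤ i → i < n → h i ≠ u) ∧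
    (u < h (n - 1) → LastBound c h n (n - 1))

theorem gapAdj_lt {a b : ℤ} (hab : a < b) (h : b ≠ 0) (h' : a ≠ 0 ∨ 1 < b) :
    gapAdj a < gapAdj b := by
  unfold gapAdj; split_ifs <;> omega

theorem sum_step (n i : ℕ) (hi : i < n) (g g' : ℕ → ℤ) (h1 : ∀ j, j ≠ i → g' j = g j)
    (h2 : g i + 1 ≤ g' i) :
    ∑ j ∈ Finset.range n, g j + 1 ≤ ∑ j ∈ Finset.range n, g' j := by
  have : ∑ j ∈ Finset.range n, g j < ∑ j ∈ Finset.range n, g' j := by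
    apply Finset.sum_lt_sum
    · intro j _
      by_cases hj : j = i
      · subst hj; omega
      · rw [h1 j hj]
    · exact ⟨i, Finset.mem_range.2 hi, by omega⟩
  omega

theorem sum_bound (n : ℕ) (g : ℕ → ℤ) (M : ℤ) (hM : ∀ i, g i ≤ M) (j : ℕ) (hj : j < n - 1) :
    ∑ i ∈ Finset.range n, g i ≤ n * M - (M - g j) - (M - g (n - 1)) := by
  obtain ⟨m, rfl⟩ : ∃ m, n = m + 1 := ⟨n - 1, by omega⟩
  have h1 : M - g j ≤ ∑ i ∈ Finset.range m, (M - g i) :=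
    Finset.single_le_sum (f := fun i => M - g i) (fun i _ => by have := hM i; simp; omega)
      (Finset.mem_range.2 (by simpa using hj))
  rw [Finset.sum_sub_distrib] at h1
  simp only [Finset.sum_const, Finset.card_range, nsmul_eq_mul] at h1
  rw [Finset.sum_range_succ]
  simp only [Nat.add_sub_cancel]
  push_cast
  linarith

theorem LabBasic.anti {h : ℕ → ℤ} (hb : LabBasic h) {i j : ℕ} (hij : i ≤ j) : h j ≤ h i :=
  antitone_nat_of_succ_le hb.1 hij

theorem LabBasic.step {C : Type*} {c : ℤ → C} {n i : ℕ} {h h' : ℕ → ℤ} (hb : LabBasic h)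
    (hs : LabStep c n i h h') : LabBasic h' := by
  obtain ⟨h1, h2⟩ := hb
  obtain ⟨hi, hne, hc⟩ := hs
  have up : ∀ j, h j ≤ h' j := by
    intro j
    by_cases hj : j = i
    · subst hj
      rcases hc with ⟨rfl, _, h3⟩ | ⟨h0, _, h3⟩
      · omega
      · have := h1 (j - 1)
        rw [Nat.sub_add_cancel h0] at this
        omega
    · rw [hne j hj]
  refine ⟨fun j => ?_, fun j => (h2 j).trans (up j)⟩
  by_cases hj : j + 1 = i
  · rcases hc with ⟨rfl, _, h3⟩ | ⟨h0, _, h3⟩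
    · omega
    · subst hj
      rw [h3]
      exact up j
  · rw [hne _ hj]
    exact (h1 j).trans (up j)

theorem step_lt {C : Type*} {c : ℤ → C} {n i : ℕ} {h h' : ℕ → ℤ} (hb : LabBasic h)
    (hs : LabStep c n i h h') : h i < h' i := by
  obtain ⟨hi, hne, hc⟩ := hs
  rcases hc with ⟨rfl, _, h3⟩ | ⟨h0, h4, h3⟩
  · omega
  · have h5 : h i ≤ h (i - 1) := hb.anti (by omega)
    have : h i ≠ h (i - 1) := fun h => h4 (by rw [h])
    omega

theorem LastBound.step {C : Type*} {c : ℤ → C} {n i : ℕ} {d : ℤ} {h h' : ℕ → ℤ}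
    (hn : 3 ≤ n) (hcs : ∀ a : ℤ, 0 ≤ a → c a ≠ c (a + 1))
    (hb : LabBasic h) (hs : LabStep c n i h h') (hl : LastBound c h n d) :
    LastBound c h' n d := by
  have hlt := step_lt hb hs
  obtain ⟨hi, hne, hc⟩ := hs
  obtain ⟨l1, l2⟩ := hl
  have hpos := hb.2 0
  by_cases hi0 : i = 0
  · subst hi0
    rcases hc with ⟨-, h4, h3⟩ | ⟨h0, _⟩
    swap
    · omega
    unfold LastBound
    rw [hne (n - 1) (by omega), h3]
    have key : h (n - 1) ≠ h 0 - d := by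
      intro he
      obtain ⟨h5, h6⟩ := l2 he
      have := hcs (h 0 - 1) (by omega)
      rw [← h6, ← he, sub_add_cancel] at this
      exact this h4.symm
    refine ⟨by omega, fun he => ⟨by push_cast at hpos; omega, ?_⟩⟩
    rw [← he, add_sub_cancel_right, h4]
  · have e0 : h' 0 = h 0 := hne 0 (by omega)
    by_cases hin : n - 1 = i
    · unfold LastBound
      rw [e0, hin]
      rw [hin] at l1
      exact ⟨by omega, fun he => by omega⟩
    · unfold LastBound
      rw [e0, hne _ hin]
      exact ⟨l1, l2⟩

theorem LabBad.lt {C : Type*} {c : ℤ → C} {n : ℕ} {h : ℕ → ℤ} (hbad : LabBad c n h) :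
    h (n - 1) < h 0 := by
  rcases hbad with ⟨i, _, _, h1, h2⟩ | ⟨_, h2⟩ <;> omega

theorem missing_label (n : ℕ) (hn : 3 ≤ n) (h : ℕ → ℤ) (h1 : 0 ≤ h 1) :
    ∃ u : ℤ, -((n : ℤ) - 1) ≤ u ∧ u ≤ -1 ∧ ∀ i, 1 ≤ i → i < n → h i ≠ u := by
  by_contra! hcon
  have : Finset.Icc (-((n : ℤ) - 1)) (-1) ⊆ (Finset.Ico 2 n).image h := by
    intro u hu
    rw [Finset.mem_Icc] at hu
    obtain ⟨i, hi1, hi2, rfl⟩ := hcon u hu.1 hu.2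
    refine Finset.mem_image_of_mem _ (Finset.mem_Ico.2 ⟨?_, hi2⟩)
    rcases Nat.lt_or_ge i 2 with h3 | h3
    · have : i = 1 := by omega
      subst this
      omega
    · exact h3
  have := (Finset.card_le_card this).trans Finset.card_image_le
  simp at this
  omega

theorem branch_step {C : Type*} {c : ℤ → C} {n i t : ℕ} {h h' : ℕ → ℤ}
    (hn : 3 ≤ n) (hc : ∀ a b : ℤ, 0 ≤ a → a < b → b - a < n - 1 → c a ≠ c b)
    (hb : LabBasic h) (hs : LabStep c n i h h') (hbad : LabBad c n h)
    (hl : LastBound c h n n) (hm : h 0 ≤ n - 1)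
    (hbr : BranchA n t h ∨ BranchB c n h) :
    h' 0 ≤ n - 1 ∧ (BranchA n (t + 1) h' ∨ BranchB c n h') := by
  have hlt := step_lt hb hs
  have hb' := hb.step hs
  have hv := hbad.lt
  have hpos := hb.2 0
  have hcs : ∀ a : ℤ, 0 ≤ a → c a ≠ c (a + 1) := fun a ha => hc a (a + 1) ha (by omega) (by omega)
  have hl' := hl.step hn hcs hb hs
  have hlB : LastBound c h n (n - 1) → LastBound c h' n (n - 1) := fun hh => hh.step hn hcs hb hs
  obtain ⟨hi, hne, hst⟩ := hs
  push_cast at hpos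
  by_cases hi0 : i = 0
  · subst hi0
    rcases hst with ⟨-, h4, h3⟩ | ⟨h0, _⟩
    swap
    · omega
    have hlast : h' (n - 1) = h (n - 1) := hne _ (by omega)
    have hl1 := hl'.1
    rw [hlast, h3] at hl1
    -- the last label is negative or zero
    have hz : h (n - 1) < 0 ∨ (h (n - 1) = 0 ∧ h 0 = n - 1) := by
      by_contra! hcon
      refine hc (h (n - 1)) (h 0) (by omega) hv ?_ h4.symm
      by_contra hcon2
      have := hcon.2 (by omega)
      omega
    rcases hbr with hA | hB
    · have hz' : h (n - 1) < 0 := by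
        rcases hz with hz | hz
        · exact hz
        · exact absurd hz.1 (hA.1 _ (by omega))
      refine ⟨by omega, Or.inl ⟨fun j hj => ?_, ?_⟩⟩
      · rw [hne j (by omega)]
        exact hA.1 j hj
      · have h6 := hA.2
        obtain ⟨m, rfl⟩ : ∃ m, n = m + 1 := ⟨n - 1, by omega⟩
        rw [Finset.sum_range_succ'] at h6 ⊢
        have : ∑ k ∈ Finset.range m, (gapAdj (h' (k + 1)) + ((k + 1 : ℕ) : ℤ)) =
            ∑ k ∈ Finset.range m, (gapAdj (h (k + 1)) + ((k + 1 : ℕ) : ℤ)) :=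
          Finset.sum_congr rfl fun k _ => by rw [hne (k + 1) (by omega)]
        rw [this, h3]
        push_cast at h6 ⊢
        linarith
    · obtain ⟨hB0, u, hu1, hu2, hu3, hu4⟩ := hB
      have hz' : h (n - 1) < 0 := by omega
      have hne' := hu3 (n - 1) (by omega) (by omega)
      have hle : h 0 + 1 ≤ n - 2 := by
        by_contra hcon
        have h7 := (hlB (hu4 (by omega))).1
        rw [hlast, h3] at h7
        omega
      refine ⟨by omega, Or.inr ⟨by omega, u, hu1, hu2, fun j hj hjn => ?_, fun hh => ?_⟩⟩
      · rw [hne j (by omega)]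
        exact hu3 j hj hjn
      · rw [hlast] at hh
        exact hlB (hu4 hh)
  · have e0 : h' 0 = h 0 := hne 0 (by omega)
    rcases hst with ⟨h0, _⟩ | ⟨-, h4, h3⟩
    · omega
    refine ⟨by omega, ?_⟩
    rcases hbr with hA | hB
    · by_cases hzero : h' i = 0
      · have hi1 : i = 1 := by
          by_contra hcon
          exact hA.1 (i - 1) (by omega) (by omega)
        subst hi1
        right
        have h00 : h 0 = 0 := by simpa [hzero] using h3.symm
        obtain ⟨u, hu1, hu2, hu3⟩ := missing_label n hn h' (by omega)
        refine ⟨by omega, u, hu1, hu2, hu3, fun hh => ⟨by omega, fun he => by omega⟩⟩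
      · left
        refine ⟨fun j hj => ?_, ?_⟩
        · by_cases hji : j = i
          · rw [hji]; exact hzero
          · rw [hne j hji]; exact hA.1 j hj
        · have h6 := hA.2
          have h7 := sum_step n i hi (fun j => gapAdj (h j) + j) (fun j => gapAdj (h' j) + j)
            (fun j hj => by simp only [hne j hj])
            (by have := gapAdj_lt hlt hzero (Or.inl (hA.1 i (by omega))); omega)
          beta_reduce at h7
          rw [e0]
          push_cast
          linarith
    · right
      obtain ⟨hB0, u, hu1, hu2, hu3, hu4⟩ := hB
      refine ⟨by omega, u, hu1, hu2, fun j hj hjn => ?_, fun hh => ?_⟩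
      · by_cases hji : j = i
        · subst hji
          rw [h3]
          by_cases hj1 : j = 1
          · subst hj1; simp; omega
          · exact hu3 (j - 1) (by omega) (by omega)
        · rw [hne j hji]; exact hu3 j hj hjn
      · rcases lt_trichotomy (h (n - 1)) u with h8 | h8 | h8
        · have := hl.1
          exact ⟨by omega, fun he => by omega⟩
        · exact absurd h8 (hu3 _ (by omega) (by omega))
        · exact hlB (hu4 h8)

theorem final_bound {C : Type*} {c : ℤ → C} {n t : ℕ} {h : ℕ → ℤ}
    (hn : 3 ≤ n) (hc : ∀ a b : ℤ, 0 ≤ a → a < b → b - a < n - 1 → c a ≠ c b)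
    (hb : LabBasic h) (hbad : LabBad c n h)
    (hl : LastBound c h n n) (hm : h 0 ≤ n - 1)
    (hcnt : (t : ℤ) ≤ ∑ i ∈ Finset.range n, (h i + i))
    (hbr : BranchA n t h ∨ BranchB c n h) :
    t < (3 * n + 1) * (n - 2) / 2 := by
  have hpos := hb.2 0
  push_cast at hpos
  have hv := hbad.lt
  have hid : (∑ i ∈ Finset.range n, (i : ℤ)) * 2 = n * (n - 1) := by
    have := Finset.sum_range_id_mul_two n
    zify at this
    rw [this, Nat.cast_sub (by omega)]
    push_cast; ring
  suffices hs : 2 * (t : ℤ) + 2 ≤ (3 * n + 1) * (n - 2) by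
    have h2 : 2 * t + 2 ≤ (3 * n + 1) * (n - 2) := by
      zify [show 2 ≤ n by omega]
      exact hs
    omega
  have hn' : (3 : ℤ) ≤ n := by exact_mod_cast hn
  rw [Finset.sum_add_distrib] at hcnt
  have hle : ∀ i, h i ≤ h 0 := fun i => hb.anti (Nat.zero_le i)
  by_cases hm2 : h 0 ≤ n - 2
  · rcases hbad with ⟨j, hj1, hj2, hj3, hj4⟩ | ⟨h1, h2⟩
    · have h5 := sum_bound n h (h 0) hle j hj2
      have h6 : (n : ℤ) * h 0 ≤ n * (n - 2) := by nlinarith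
      nlinarith
    · have hneg : h (n - 1) < 0 := by
        by_contra hcon
        exact hc _ _ (by omega) h2 (by omega) h1
      have h5 := sum_bound n h (h 0) hle 0 (by omega)
      by_cases h00 : h 0 = 0
      · rw [h00] at h5
        nlinarith
      · have h6 : (n : ℤ) * h 0 ≤ n * (n - 2) := by nlinarith
        have : 1 ≤ h 0 := by omega
        nlinarith
  · have hmn : h 0 = n - 1 := by omega
    rcases hbr with hA | hB
    swap
    · exact absurd hB.1 hm2
    obtain ⟨hA1, hA2⟩ := hA
    rw [Finset.sum_add_distrib] at hA2
    have hg0 : gapAdj (h 0) = n - 2 := by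
      unfold gapAdj; split_ifs <;> omega
    have hgle : ∀ i, gapAdj (h i) ≤ n - 2 := by
      intro i
      have := hle i
      unfold gapAdj; split_ifs <;> omega
    rcases hbad with ⟨j, hj1, hj2, hj3, hj4⟩ | ⟨h1, h2⟩
    · have h5 := sum_bound n (fun i => gapAdj (h i)) (n - 2) hgle j hj2
      have h6 := gapAdj_lt hj4 (by omega) (Or.inl (hA1 j hj1))
      have h7 := gapAdj_lt hj3 (hA1 j hj1) (Or.inl (hA1 (n - 1) (by omega)))
      beta_reduce at h5
      nlinarith
    · exfalso
      have h3 := hA1 (n - 1) (by omega)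
      have h4 := hl.1
      have h5 : h (n - 1) = -1 := by
        by_contra hcon
        exact hc _ _ (by omega) h2 (by omega) h1
      have h6 := (hl.2 (by omega)).2
      rw [show h 0 - n = h (n - 1) by omega, h1] at h6
      exact hc (h 0 - 1) (h 0) (by omega) (by omega) (by omega) h6.symm

theorem lab_main {C : Type*} {c : ℤ → C} {n : ℕ} (h : ℕ → ℕ → ℤ) (sl : ℕ → ℕ)
    (hn : 3 ≤ n) (hc : ∀ a b : ℤ, 0 ≤ a → a < b → b - a < n - 1 → c a ≠ c b)
    (h0 : ∀ i, h 0 i = -(i : ℤ)) (hs : ∀ k, LabStep c n (sl k) (h k) (h (k + 1)))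
    (t : ℕ) (hbad : ∀ k, k ≤ t → LabBad c n (h k)) :
    t < (3 * n + 1) * (n - 2) / 2 := by
  have hcs : ∀ a : ℤ, 0 ≤ a → c a ≠ c (a + 1) := fun a ha => hc a (a + 1) ha (by omega) (by omega)
  have hb : ∀ k, LabBasic (h k) := by
    intro k
    induction k with
    | zero => exact ⟨fun i => by rw [h0, h0]; push_cast; omega, fun i => by rw [h0]⟩
    | succ k ih => exact ih.step (hs k)
  have hl : ∀ k, LastBound c (h k) n n := by
    intro k
    induction k with
    | zero => exact ⟨by rw [h0, h0]; push_cast; omega, fun he => by rw [h0, h0] at he; omega⟩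
    | succ k ih => exact ih.step hn hcs (hb k) (hs k)
  have hcnt : ∀ k : ℕ, (k : ℤ) ≤ ∑ i ∈ Finset.range n, (h k i + i) := by
    intro k
    induction k with
    | zero => simp [h0]
    | succ k ih =>
      have h7 := sum_step n (sl k) (hs k).1 (fun j => h k j + j) (fun j => h (k + 1) j + j)
        (fun j hj => by simp only [(hs k).2.1 j hj])
        (by have := step_lt (hb k) (hs k); omega)
      beta_reduce at h7
      push_cast
      linarith
  have hbr : ∀ k, k ≤ t → h k 0 ≤ n - 1 ∧ (BranchA n k (h k) ∨ BranchB c n (h k)) := by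
    intro k
    induction k with
    | zero =>
      intro _
      refine ⟨by rw [h0]; push_cast; omega, Or.inl ⟨fun i hi => by rw [h0]; omega, ?_⟩⟩
      have : ∀ i : ℕ, gapAdj (-(i : ℤ)) = -i := fun i => by unfold gapAdj; split_ifs <;> omega
      simp only [h0, this]
      simp
    | succ k ih =>
      intro hk
      obtain ⟨i1, i2⟩ := ih (by omega)
      exact branch_step hn hc (hb k) (hs k) (hbad k (by omega)) (hl k) i1 i2
  exact final_bound hn hc (hb t) (hbad t le_rfl) (hl t) (hbr t le_rfl).1 (hcnt t) (hbr t le_rfl).2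

/-- Player `i` is enabled (not at a best response). -/
def RingEn {n : ℕ} [NeZero n] {C : Type*} (s : Fin n → C) (i : Fin n) : Prop :=
  if i = 0 then s i = s (i - 1) else s i ≠ s (i - 1)

theorem fin_pred_val {n : ℕ} [NeZero n] (hn : 3 ≤ n) (i : Fin n) :
    ((i - 1 : Fin n) : ℕ) = if (i : ℕ) = 0 then n - 1 else (i : ℕ) - 1 := by
  have hi := i.isLt
  rw [Fin.sub_def]
  simp only [Fin.val_one', Nat.mod_eq_of_lt (show 1 < n by omega)]
  split_ifs with h
  · rw [h, Nat.add_zero, Nat.mod_eq_of_lt (by omega)]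
  · rw [show n - 1 + (i : ℕ) = ((i : ℕ) - 1) + n by omega, Nat.add_mod_right,
      Nat.mod_eq_of_lt (by omega)]

theorem fin_pred_ne {n : ℕ} [NeZero n] (hn : 3 ≤ n) (i : Fin n) : i - 1 ≠ i := by
  intro h
  have h1 := fin_pred_val hn i
  rw [h] at h1
  split_ifs at h1 <;> omega

theorem notBR_iff {n : ℕ} [NeZero n] (hn : 3 ≤ n) {C : Type*} [Fintype C] [DecidableEq C]
    (hC : 1 < Fintype.card C) (s : Fin n → C) (i : Fin n) :
    ¬ BestResponse (ringPayoff (n := n) (C := C)) s i ↔ RingEn s i := by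
  have hne := fin_pred_ne hn i
  have : Nontrivial C := Fintype.one_lt_card_iff_nontrivial.1 hC
  unfold BestResponse RingEn ringPayoff
  by_cases hi : i = 0
  · simp only [if_pos hi, Function.update_self, Function.update_of_ne hne]
    constructor
    · intro h
      by_contra hcon
      apply h
      intro c
      rw [if_neg hcon]
      split_ifs <;> omega
    · intro h h2
      obtain ⟨c, hc⟩ := exists_ne (s (i - 1))
      have := h2 c
      rw [if_neg hc, if_pos h] at this
      omega
  · simp only [if_neg hi, Function.update_self, Function.update_of_ne hne]
    constructor
    · intro h hcon
      apply h
      intro c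
      rw [if_pos hcon]
      split_ifs <;> omega
    · intro h h2
      have := h2 (s (i - 1))
      rw [if_pos rfl, if_neg h] at this
      omega

/-- Labels: which source each player's colour comes from. -/
def lab (sl : ℕ → ℕ) : ℕ → ℕ → ℤ
  | 0, i => -(i : ℤ)
  | k + 1, i => if i = sl k then (if i = 0 then lab sl k 0 + 1 else lab sl k (i - 1))
      else lab sl k i

/-- Colour of a label. -/
def labCol {n : ℕ} [NeZero n] {C : Type*} (π : Equiv.Perm C) (s : Fin n → C) (z : ℤ) : C :=
  if 0 ≤ z then (π ^ z.toNat) (s 0) else s (Fin.ofNat n (-z).toNat)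

theorem perm_period {C : Type*} [Fintype C] (π : Equiv.Perm C)
    (hπ : ∀ x y : C, ∃ k : ℕ, (π ^ k) x = y) (x : C) (d : ℕ) (hd : 0 < d)
    (h : (π ^ d) x = x) : Fintype.card C ≤ d := by
  have hsurj : Function.Surjective (fun j : Fin d => (π ^ (j : ℕ)) x) := by
    intro y
    obtain ⟨k, hk⟩ := hπ x y
    refine ⟨⟨k % d, Nat.mod_lt _ hd⟩, ?_⟩
    simp only
    rw [← hk]
    conv_rhs => rw [← Nat.mod_add_div k d, pow_add, pow_mul, Equiv.Perm.mul_apply,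
      Equiv.Perm.pow_apply_eq_self_of_apply_eq_self h]
  simpa using Fintype.card_le_of_surjective _ hsurj

theorem labCol_ne {n : ℕ} [NeZero n] {C : Type*} [Fintype C] (hC : n - 1 ≤ Fintype.card C)
    (π : Equiv.Perm C) (hπ : ∀ x y : C, ∃ k : ℕ, (π ^ k) x = y) (s : Fin n → C)
    (a b : ℤ) (ha : 0 ≤ a) (hab : a < b) (hd : b - a < n - 1) :
    labCol π s a ≠ labCol π s b := by
  unfold labCol
  rw [if_pos ha, if_pos (by omega)]
  intro h
  obtain ⟨d, hd'⟩ : ∃ d, b.toNat = a.toNat + d := ⟨b.toNat - a.toNat, by omega⟩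
  rw [hd', pow_add, Equiv.Perm.mul_apply] at h
  have := perm_period π hπ (s 0) d (by omega) ((π ^ a.toNat).injective h).symm
  omega

/-- Consider the ring game `G` with `n ≥ 3` players and a set of
colours `C` with `|C| ≥ n - 1`, together with a fixed cyclic order on `C` (a
permutation `π` of `C` consisting of a single cycle through all elements of `C`).
Every scheduler `f` (a function that, at any joint strategy `s` and any player `i`
not playing a best response in `s`, returns a better response `f s i` for `i`)
satisfying `f s 0 = π (s 0)` (player `1`, indexed `0`, is always told to switch to
the successor of its current colour) ensures self-stabilization in
`(3n+1)(n-2)/2` steps: in every improvement path generated by `f`, every player is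
selected infinitely often and every joint strategy occurring after the first
`(3n+1)(n-2)/2` steps is legitimate. -/
theorem ring_game_scheduler_self_stabilization_bound
    (n : ℕ) [NeZero n] (hn : 3 ≤ n)
    (C : Type*) [Fintype C] [DecidableEq C] (hC : n - 1 ≤ Fintype.card C)
    (π : Equiv.Perm C) (hπ : ∀ x y : C, ∃ k : ℕ, (π ^ k) x = y)
    (f : (Fin n → C) → Fin n → C)
    (hsched : ∀ (s : Fin n → C) (i : Fin n),
      ¬ BestResponse (ringPayoff (n := n) (C := C)) s i →
      ringPayoff s i < ringPayoff (Function.update s i (f s i)) i)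
    (hf0 : ∀ s : Fin n → C, f s 0 = π (s 0))
    (σ : ℕ → Fin n → C) (sel : ℕ → Fin n)
    (hgen : ∀ k : ℕ,
      ¬ BestResponse (ringPayoff (n := n) (C := C)) (σ k) (sel k) ∧
      σ (k + 1) = Function.update (σ k) (sel k) (f (σ k) (sel k))) :
    (∀ (i : Fin n) (k : ℕ), ∃ m, k ≤ m ∧ sel m = i) ∧
    (∀ m : ℕ, (3 * n + 1) * (n - 2) / 2 ≤ m →
      Legitimate (ringPayoff (n := n) (C := C)) (σ m)) := by
  have hC1 : 1 < Fintype.card C := by omega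
  have hBR := fun s i => notBR_iff (n := n) (C := C) hn hC1 s i
  have hen : ∀ k, RingEn (σ k) (sel k) := fun k => (hBR _ _).1 (hgen k).1
  have hsame : ∀ k j, j ≠ sel k → σ (k + 1) j = σ k j := by
    intro k j hj
    rw [(hgen k).2, Function.update_of_ne hj]
  have hmove0 : ∀ k, sel k = 0 → σ (k + 1) 0 = π (σ k 0) := by
    intro k hk
    rw [(hgen k).2, hk, Function.update_self, hf0]
  have hmove : ∀ k, sel k ≠ 0 → σ (k + 1) (sel k) = σ k (sel k - 1) := by
    intro k hk
    have h1 := hsched _ _ (hgen k).1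
    rw [(hgen k).2, Function.update_self]
    by_contra hcon
    unfold ringPayoff at h1
    rw [if_neg hk, if_neg hk, Function.update_self, Function.update_of_ne (fin_pred_ne hn _),
      if_neg hcon] at h1
    omega
  have hoff : ∀ k, ¬ RingEn (σ (k + 1)) (sel k) := by
    intro k
    have hp := hsame k (sel k - 1) (fin_pred_ne hn _)
    have he := hen k
    unfold RingEn at he ⊢
    by_cases hk : sel k = 0
    · rw [if_pos hk] at he ⊢
      rw [hp, ← he, hk, hmove0 k hk]
      intro h
      have := perm_period π hπ (σ k 0) 1 one_pos (by simpa using h)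
      omega
    · rw [if_neg hk]
      rw [hmove k hk, hp]
      simp
  have hkeep : ∀ k j, j ≠ sel k → j - 1 ≠ sel k → (RingEn (σ (k + 1)) j ↔ RingEn (σ k) j) := by
    intro k j h1 h2
    unfold RingEn
    rw [hsame k j h1, hsame k _ h2]
  refine ⟨?_, ?_⟩
  · -- every player is selected infinitely often
    by_contra! hcon
    obtain ⟨i0, k0, hk0⟩ := hcon
    have step : ∀ i : Fin n, (∃ k, ∀ m, k ≤ m → sel m ≠ i - 1) → ∃ k, ∀ m, k ≤ m → sel m ≠ i := by
      rintro i ⟨k, hk⟩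
      by_contra! hcon
      obtain ⟨m, hm, hmi⟩ := hcon k
      have hne : ∀ d, ¬ RingEn (σ (m + 1 + d)) i := by
        intro d
        induction d with
        | zero => rw [← hmi]; exact hoff m
        | succ d ih =>
          rw [← Nat.add_assoc, hkeep]
          · exact ih
          · intro h
            apply ih
            rw [h]
            exact hen _
          · exact fun h => hk _ (by omega) h.symm
      obtain ⟨m', hm', hmi'⟩ := hcon (m + 1)
      obtain ⟨d, rfl⟩ := Nat.exists_eq_add_of_le hm'
      apply hne d
      rw [← hmi']
      exact hen _
    have q1 : ∀ v, ∀ (hv : v + 1 < n), (∃ k, ∀ m, k ≤ m → sel m ≠ ⟨v, by omega⟩) →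
        (∃ k, ∀ m, k ≤ m → sel m ≠ ⟨v + 1, hv⟩) := by
      intro v hv h
      apply step
      have : (⟨v + 1, hv⟩ - 1 : Fin n) = ⟨v, by omega⟩ := by
        ext; rw [fin_pred_val hn]; simp
      rw [this]; exact h
    have q2 : ∀ d, ∀ (hv : (i0 : ℕ) + d < n), ∃ k, ∀ m, k ≤ m → sel m ≠ ⟨i0 + d, hv⟩ := by
      intro d
      induction d with
      | zero => exact fun hv => ⟨k0, hk0⟩
      | succ d ih => exact fun hv => q1 _ hv (ih (by omega))
    have q3 : ∃ k, ∀ m, k ≤ m → sel m ≠ ⟨0, by omega⟩ := by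
      apply step
      have : (⟨0, by omega⟩ - 1 : Fin n) = ⟨(i0 : ℕ) + (n - 1 - i0), by omega⟩ := by
        ext; rw [fin_pred_val hn]; simp; omega
      rw [this]; exact q2 _ _
    have q4 : ∀ v, ∀ (hv : v < n), ∃ k, ∀ m, k ≤ m → sel m ≠ ⟨v, hv⟩ := by
      intro v
      induction v with
      | zero => exact fun hv => q3
      | succ d ih => exact fun hv => q1 _ hv (ih (by omega))
    have q5 : ∀ i : Fin n, ∃ k, ∀ m, k ≤ m → sel m ≠ i := fun i => q4 i i.isLt
    choose g hg using q5
    exact hg (sel (Finset.univ.sup g)) _ (Finset.le_sup (Finset.mem_univ _)) rfl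
  · intro t ht
    by_contra hleg
    have hclosed : ∀ k, Legitimate (ringPayoff (n := n) (C := C)) (σ k) →
        Legitimate (ringPayoff (n := n) (C := C)) (σ (k + 1)) := by
      rintro k ⟨i, hi1, hi2⟩
      have hsi : sel k = i := hi2 _ (hgen k).1
      have key : ∀ j, RingEn (σ (k + 1)) j → j - 1 = sel k := by
        intro j hj
        have hj1 : j ≠ sel k := by
          rintro rfl
          exact hoff k hj
        by_contra hj2
        rw [hkeep k j hj1 hj2] at hj
        exact hj1 (by rw [hsi]; exact hi2 j ((hBR _ _).2 hj))
      refine ⟨sel (k + 1), (hgen (k + 1)).1, fun j hj => ?_⟩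
      have a1 := key j ((hBR _ _).1 hj)
      have a2 := key _ (hen (k + 1))
      have b1 := fin_pred_val hn j
      have b2 := fin_pred_val hn (sel (k + 1))
      rw [a1] at b1
      rw [a2] at b2
      have := j.isLt
      have := (sel (k + 1)).isLt
      ext
      split_ifs at b1 b2 <;> omega
    have hbadk : ∀ k, k ≤ t → ¬ Legitimate (ringPayoff (n := n) (C := C)) (σ k) := by
      intro k hk hl
      apply hleg
      obtain ⟨d, rfl⟩ := Nat.exists_eq_add_of_le hk
      clear hk ht hleg
      induction d with
      | zero => exact hl
      | succ d ih => exact hclosed _ ih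
    let sl : ℕ → ℕ := fun k => (sel k : ℕ)
    let c : ℤ → C := labCol π (σ 0)
    have hlow : ∀ k, 0 ≤ lab sl k 0 := by
      intro k
      induction k with
      | zero => simp [lab]
      | succ k ih =>
        rw [lab]
        split_ifs with h1 <;> omega
    have hcol : ∀ k (i : Fin n), σ k i = c (lab sl k i) := by
      intro k
      induction k with
      | zero =>
        intro i
        simp only [lab, c, labCol]
        split_ifs with h
        · have : i = 0 := by
            apply Fin.ext; rw [Fin.val_zero]; omega
          subst this
          simp
        · congr 1
          ext
          simp [Nat.mod_eq_of_lt i.isLt]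
      | succ k ih =>
        intro i
        rw [lab]
        by_cases hi : i = sel k
        · rw [if_pos (by rw [hi])]
          by_cases hi0 : i = 0
          · subst hi0
            rw [if_pos (by simp), hmove0 k hi.symm, ih 0]
            have := hlow k
            simp only [c, labCol, Fin.val_zero]
            rw [if_pos this, if_pos (by omega), show (lab sl k 0 + 1).toNat =
              (lab sl k 0).toNat + 1 by omega, pow_succ', Equiv.Perm.mul_apply]
          · have hi0' : (i : ℕ) ≠ 0 := fun h => hi0 (by ext; simpa using h)
            rw [if_neg hi0', hi, hmove k (hi ▸ hi0), ih, fin_pred_val hn, ← hi, if_neg hi0']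
        · rw [if_neg (fun h => hi (Fin.ext h)), hsame k i hi, ih]
    have hEn : ∀ k (i : Fin n), RingEn (σ k) i →
        ((i : ℕ) = 0 ∧ c (lab sl k 0) = c (lab sl k (n - 1))) ∨
        (0 < (i : ℕ) ∧ c (lab sl k i) ≠ c (lab sl k (i - 1))) := by
      intro k i h
      unfold RingEn at h
      rw [hcol, hcol, fin_pred_val hn] at h
      by_cases hi0 : i = 0
      · left
        subst hi0
        simpa using h
      · have hi0' : (i : ℕ) ≠ 0 := fun h => hi0 (by ext; simpa using h)
        right
        rw [if_neg hi0, if_neg hi0'] at h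
        exact ⟨by omega, h⟩
    have hstep : ∀ k, LabStep c n (sl k) (lab sl k) (lab sl (k + 1)) := by
      intro k
      refine ⟨(sel k).isLt, fun j hj => by rw [lab, if_neg hj], ?_⟩
      rcases hEn k _ (hen k) with ⟨h1, h2⟩ | ⟨h1, h2⟩
      · left
        exact ⟨h1, h2, by rw [lab, if_pos h1.symm, if_pos rfl]⟩
      · right
        exact ⟨h1, h2, by rw [lab, if_pos rfl, if_neg (by simp only [sl]; omega)]⟩
    have hb : ∀ k, LabBasic (lab sl k) := by
      intro k
      induction k with
      | zero => exact ⟨fun i => by simp [lab], fun i => by simp [lab]⟩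
      | succ k ih => exact ih.step (hstep k)
    have two : ∀ k (i j : Fin n), RingEn (σ k) i → RingEn (σ k) j → (i : ℕ) < j →
        LabBad c n (lab sl k) := by
      intro k i j h1 h2 hij
      have hj := j.isLt
      have hlt : ∀ a : ℕ, c (lab sl k a) ≠ c (lab sl k (a - 1)) → lab sl k a < lab sl k (a - 1) :=
        fun a ha => lt_of_le_of_ne ((hb k).anti (by omega)) (fun h => ha (by rw [h]))
      rcases hEn k j h2 with ⟨h3, _⟩ | ⟨h3, h4⟩
      · omega
      have h5 := hlt _ h4
      have h6 : lab sl k (n - 1) ≤ lab sl k j := (hb k).anti (by omega)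
      have h7 : lab sl k (j - 1) ≤ lab sl k i := (hb k).anti (by omega)
      rcases hEn k i h1 with ⟨h8, h9⟩ | ⟨h8, h9⟩
      · right
        rw [h8] at h7
        exact ⟨h9.symm, by omega⟩
      · left
        have h10 := hlt _ h9
        have h11 : lab sl k (i - 1) ≤ lab sl k 0 := (hb k).anti (by omega)
        exact ⟨i, h8, by omega, by omega, by omega⟩
    have hbad : ∀ k, k ≤ t → LabBad c n (lab sl k) := by
      intro k hk
      have h1 := hbadk k hk
      have h2 : ∃ j, RingEn (σ k) j ∧ j ≠ sel k := by
        by_contra! hcon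
        exact h1 ⟨sel k, (hgen k).1, fun j hj => hcon j ((hBR _ _).1 hj)⟩
      obtain ⟨j, hj, hjs⟩ := h2
      rcases Nat.lt_trichotomy (j : ℕ) (sel k) with h3 | h3 | h3
      · exact two k j _ hj (hen k) h3
      · exact absurd (Fin.ext h3) hjs
      · exact two k _ j (hen k) hj h3
    have := lab_main (c := c) (lab sl) sl hn (labCol_ne hC π hπ (σ 0)) (fun i => by rw [lab])
      hstep t hbad
    omega
end

section
/- In the three-state game on n >= 3 players, every scheduler f satisfying f(s, 1) = s_1 ⊕ 2, f(s, i) = s_i ⊕ 1 for 1 < i < n, and f(s, n) = s_1 ⊕ 1 ensures self-stabilization: in every improvement path generated by f, every player is selected infinitely often and, from a certain point on, every joint strategy in it is legitimate. -/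
/-- Payoff in the three-state game on `n` players (indexed `0, …, n-1`, so the
bottom machine is player `0` and the top machine is player `n-1`), with strategies
in `ZMod 3` (i.e. `{0, 1, 2}` with `+` being addition modulo `3`):
`p 0 s = 0` if `s 0 + 1 = s 1` and `1` otherwise;
for `0 < i < n-1`, `p i s = 0` if both `s i + 1` and `s i + 2` belong to
`{s (i-1), s (i+1)}`, `p i s = 1` if `s i + 1 ∈ {s (i-1), s (i+1)}` but
`s i + 2 ∉ {s (i-1), s (i+1)}`, and `p i s = 2` otherwise;
`p (n-1) s = 0` if `s 0 = s (n-2)` and `s (n-1) ≠ s 0 + 1`, and `1` otherwise. -/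
def threePayoff (n : ℕ) [NeZero n] (s : Fin n → ZMod 3) (i : Fin n) : ℕ :=
  if i = 0 then (if s 0 + 1 = s 1 then 0 else 1)
  else if i.val = n - 1 then (if s 0 = s (i - 1) ∧ s i ≠ s 0 + 1 then 0 else 1)
  else
    if (s i + 1 = s (i - 1) ∨ s i + 1 = s (i + 1)) ∧
       (s i + 2 = s (i - 1) ∨ s i + 2 = s (i + 1)) then 0
    else if s i + 1 = s (i - 1) ∨ s i + 1 = s (i + 1) then 1
    else 2

namespace ThreeState

/-- Difference of adjacent strategies: `1` is an arrow moving left, `2` an arrow moving right. -/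
def dd (x : ℕ → ZMod 3) (j : ℕ) : ZMod 3 := x (j + 1) - x j

inductive Step (N : ℕ) (x x' : ℕ → ZMod 3) : ℕ → Prop
  | bot : x 0 + 1 = x 1 → x' = Function.update x 0 (x 0 + 2) → Step N x x' 0
  | mid (i : ℕ) : i < N → (x (i + 1) + 1 = x i ∨ x (i + 1) + 1 = x (i + 2)) →
      x' = Function.update x (i + 1) (x (i + 1) + 1) → Step N x x' (i + 1)
  | top : x 0 = x N → x (N + 1) ≠ x 0 + 1 →
      x' = Function.update x (N + 1) (x 0 + 1) → Step N x x' (N + 1)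

/-- The effect of a step on the arrows. -/
inductive DStep (N : ℕ) (x x' : ℕ → ZMod 3) : ℕ → Prop
  | bot : dd x 0 = 1 → dd x' 0 = 2 → (∀ j, j ≠ 0 → dd x' j = dd x j) → DStep N x x' 0
  | mid (i : ℕ) : i < N → (dd x i = 2 ∨ dd x (i + 1) = 1) → dd x' i = dd x i + 1 →
      dd x' (i + 1) = dd x (i + 1) + 2 → (∀ j, j ≠ i → j ≠ i + 1 → dd x' j = dd x j) →
      x' 0 = x 0 → x' (N + 1) = x (N + 1) → DStep N x x' (i + 1)
  | top : x 0 = x N → dd x N ≠ 1 → dd x' N = 1 → (∀ j, j < N → dd x' j = dd x j) →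
      x (N + 1) ≠ x 0 + 1 → x' (N + 1) = x' 0 + 1 → DStep N x x' (N + 1)

theorem z1 : ∀ a b : ZMod 3, a + 1 = b → b - a = 1 := by decide
theorem z2 : ∀ a b : ZMod 3, a + 1 = b → b - (a + 2) = 2 := by decide
theorem z3 : ∀ a b : ZMod 3, a + 1 = b → a - b = 2 := by decide
theorem z4 : ∀ a b : ZMod 3, b - (a + 1) = b - a + 2 := by decide
theorem z5 : ∀ a b : ZMod 3, a ≠ b + 1 → a - b ≠ 1 := by decide
theorem zc : ∀ a : ZMod 3, a = 0 ∨ a = 1 ∨ a = 2 := by decide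

theorem Step.toD {N : ℕ} (hN : 1 ≤ N) {x x' : ℕ → ZMod 3} {i : ℕ} (h : Step N x x' i) :
    DStep N x x' i := by
  cases h with
  | bot h1 h2 =>
    subst h2
    refine .bot (z1 _ _ h1) ?_ ?_
    · simpa [dd, Function.update_apply] using z2 _ _ h1
    · intro j hj
      simp [dd, hj]
  | mid i hi h1 h2 =>
    subst h2
    refine .mid i hi ?_ ?_ ?_ ?_ ?_ ?_
    · rcases h1 with h1 | h1
      · exact Or.inl (z3 _ _ h1)
      · exact Or.inr (z1 _ _ h1)
    · simp [dd, Function.update_apply]; ring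
    · simpa [dd, Function.update_apply] using z4 _ _
    · intro j hj hj'
      simp [dd, hj, hj']
    · simp
    · have : N ≠ i := by omega
      simp [this]
  | top h1 h2 h3 =>
    subst h3
    refine .top h1 ?_ ?_ ?_ h2 ?_
    · rw [h1] at h2; exact z5 _ _ h2
    · simp [dd, Function.update_apply, h1]
    · intro j hj
      have a1 : j ≠ N := by omega
      have a2 : j ≠ N + 1 := by omega
      simp [dd, a1, a2]
    · simp

def NoArr (N : ℕ) (x : ℕ → ZMod 3) : Prop := ∀ j, j ≤ N → dd x j = 0

def Arr (N : ℕ) (c : ZMod 3) (j : ℕ) (x : ℕ → ZMod 3) : Prop :=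
  j ≤ N ∧ dd x j = c ∧ ∀ k, k ≤ N → k ≠ j → dd x k = 0

def Q (N : ℕ) (x : ℕ → ZMod 3) : Prop :=
  NoArr N x ∨ (∃ j, Arr N 1 j x) ∨ ∃ j, Arr N 2 j x

theorem n12 : (1 : ZMod 3) ≠ 2 := by decide
theorem n10 : (1 : ZMod 3) ≠ 0 := by decide
theorem n20 : (2 : ZMod 3) ≠ 0 := by decide
theorem e12 : (1 : ZMod 3) + 2 = 0 := by decide
theorem e21 : (2 : ZMod 3) + 1 = 0 := by decide
theorem e22 : (2 : ZMod 3) + 2 = 1 := by decide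
theorem e11 : (1 : ZMod 3) + 1 = 2 := by decide

theorem noArr_step {N : ℕ} {x x' : ℕ → ZMod 3} {i : ℕ} (h : DStep N x x' i)
    (hz : NoArr N x) : i = N + 1 ∧ Arr N 1 N x' := by
  cases h with
  | bot h1 => exact absurd (h1.symm.trans (hz 0 (by omega))) n10
  | mid i hi h1 =>
    rcases h1 with h1 | h1
    · exact absurd (h1.symm.trans (hz _ (by omega))) n20
    · exact absurd (h1.symm.trans (hz _ (by omega))) n10
  | top h1 h2 h3 h4 =>
    refine ⟨rfl, le_rfl, h3, fun k hk hk' => ?_⟩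
    rw [h4 k (by omega)]; exact hz k hk

theorem const_of {x : ℕ → ZMod 3} (a b : ℕ) (hab : a ≤ b)
    (h : ∀ k, a ≤ k → k < b → dd x k = 0) : x a = x b := by
  induction b, hab using Nat.le_induction with
  | base => rfl
  | succ b hb ih =>
    rw [ih fun k h1 h2 => h k h1 (by omega)]
    exact (sub_eq_zero.mp (h b hb (by omega))).symm

theorem arr_top {N : ℕ} {c : ZMod 3} {x : ℕ → ZMod 3} {j : ℕ} (hc : c ≠ 0) (hz : Arr N c j x)
    (h : x 0 = x N) : j = N := by
  obtain ⟨h1, h2, h3⟩ := hz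
  by_contra hne
  have a1 : x 0 = x j := const_of 0 j (by omega) fun k _ _ => h3 k (by omega) (by omega)
  have a2 : x (j + 1) = x N := const_of (j + 1) N (by omega)
    fun k _ _ => h3 k (by omega) (by omega)
  apply hc
  rw [← h2, dd, a2, ← h, a1, sub_self]

theorem arr1_step {N : ℕ} {x x' : ℕ → ZMod 3} {i j : ℕ} (h : DStep N x x' i)
    (hz : Arr N 1 j x) : i = j ∧ (j = 0 → Arr N 2 0 x') ∧
      ∀ j', j = j' + 1 → Arr N 1 j' x' := by
  have hj := hz.1
  have hd := hz.2.1
  have hr := hz.2.2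
  cases h with
  | bot h1 h2 h3 =>
    have : j = 0 := by
      by_contra hne
      exact absurd (h1.symm.trans (hr 0 (by omega) (by omega))) n10
    subst this
    refine ⟨rfl, fun _ => ⟨by omega, h2, fun k hk hk' => ?_⟩, by omega⟩
    rw [h3 k hk']; exact hr k hk hk'
  | mid i hi h1 h2 h3 h4 =>
    have : i + 1 = j := by
      by_contra hne
      rcases h1 with h1 | h1
      · by_cases e : i = j
        · subst e; exact absurd (hd.symm.trans h1) n12
        · exact absurd (h1.symm.trans (hr i (by omega) e)) n20
      · exact absurd (h1.symm.trans (hr _ (by omega) hne)) n10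
    subst this
    refine ⟨rfl, by omega, fun j' hj' => ?_⟩
    have : j' = i := by omega
    subst this
    refine ⟨by omega, ?_, fun k hk hk' => ?_⟩
    · rw [h2, hr _ (by omega) (by omega), zero_add]
    · by_cases e : k = j' + 1
      · subst e; rw [h3, hd, e12]
      · rw [h4 k hk' e]; exact hr k hk e
  | top h1 h2 =>
    have := arr_top n10 hz h1
    subst this
    exact absurd hd h2

theorem arr2_step {N : ℕ} {x x' : ℕ → ZMod 3} {i j : ℕ} (h : DStep N x x' i)
    (hz : Arr N 2 j x) : i = j + 1 ∧ (j < N → Arr N 2 (j + 1) x') ∧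
      (j = N → Arr N 1 N x') := by
  have hj := hz.1
  have hd := hz.2.1
  have hr := hz.2.2
  cases h with
  | bot h1 h2 h3 =>
    exfalso
    by_cases e : j = 0
    · subst e; exact n12 (h1.symm.trans hd)
    · exact absurd (h1.symm.trans (hr 0 (by omega) (by omega))) n10
  | mid i hi h1 h2 h3 h4 =>
    have : i = j := by
      by_contra hne
      rcases h1 with h1 | h1
      · exact absurd (h1.symm.trans (hr i (by omega) hne)) n20
      · by_cases e : i + 1 = j
        · subst e; exact n12 (h1.symm.trans hd)
        · exact absurd (h1.symm.trans (hr _ (by omega) e)) n10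
    subst this
    refine ⟨rfl, fun _ => ⟨by omega, ?_, fun k hk hk' => ?_⟩, by omega⟩
    · rw [h3, hr _ (by omega) (by omega), zero_add]
    · by_cases e : k = i
      · subst e; rw [h2, hd, e21]
      · rw [h4 k e hk']; exact hr k hk e
  | top h1 h2 h3 h4 =>
    have := arr_top n20 hz h1
    subst this
    refine ⟨rfl, by omega, fun _ => ⟨le_rfl, h3, fun k hk hk' => ?_⟩⟩
    rw [h4 k (by omega)]; exact hr k hk hk'

theorem Q_step {N : ℕ} {x x' : ℕ → ZMod 3} {i : ℕ} (h : DStep N x x' i) (hq : Q N x) :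
    Q N x' := by
  rcases hq with hq | ⟨j, hq⟩ | ⟨j, hq⟩
  · exact Or.inr (Or.inl ⟨_, (noArr_step h hq).2⟩)
  · obtain ⟨-, h1, h2⟩ := arr1_step h hq
    rcases j with _ | j
    · exact Or.inr (Or.inr ⟨_, h1 rfl⟩)
    · exact Or.inr (Or.inl ⟨_, h2 _ rfl⟩)
  · obtain ⟨-, h1, h2⟩ := arr2_step h hq
    rcases hq.1.lt_or_eq with e | e
    · exact Or.inr (Or.inr ⟨_, h1 e⟩)
    · exact Or.inr (Or.inl ⟨_, h2 e⟩)

theorem Q_unique {N : ℕ} {x x' x'' : ℕ → ZMod 3} {i i' : ℕ} (h : DStep N x x' i)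
    (h' : DStep N x x'' i') (hq : Q N x) : i = i' := by
  rcases hq with hq | ⟨j, hq⟩ | ⟨j, hq⟩
  · exact (noArr_step h hq).1.trans (noArr_step h' hq).1.symm
  · exact (arr1_step h hq).1.trans (arr1_step h' hq).1.symm
  · exact (arr2_step h hq).1.trans (arr2_step h' hq).1.symm

/-- If `Q` fails, there is an arrow strictly below position `N`. -/
theorem exists_of_not_Q {N : ℕ} {x : ℕ → ZMod 3} (hq : ¬ Q N x) : ∃ j, j < N ∧ dd x j ≠ 0 := by
  by_contra! hcon
  apply hq
  have hr : ∀ k, k ≤ N → k ≠ N → dd x k = 0 := fun k h1 h2 => hcon k (by omega)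
  rcases zc (dd x N) with h | h | h
  · left
    intro j hj
    by_cases e : j = N
    · subst e; exact h
    · exact hr j hj e
  · exact Or.inr (Or.inl ⟨N, le_rfl, h, hr⟩)
  · exact Or.inr (Or.inr ⟨N, le_rfl, h, hr⟩)

/-- The leftmost arrow points to the left. -/
def L (N : ℕ) (x : ℕ → ZMod 3) : Prop :=
  ∃ j, j ≤ N ∧ dd x j = 1 ∧ ∀ k, k < j → dd x k = 0

def w (N : ℕ) (c : ZMod 3) (j : ℕ) : ℕ :=
  if c = 1 then 10 * (N + 4) + j else if c = 2 then 19 * (N + 4) + (N + 2 - j) else 0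

theorem w0 (N j : ℕ) : w N 0 j = 0 := by simp [w, n10.symm, n20.symm]
theorem w1 (N j : ℕ) : w N 1 j = 10 * (N + 4) + j := by simp [w]
theorem w2 (N j : ℕ) : w N 2 j = 19 * (N + 4) + (N + 2 - j) := by simp [w, n12.symm]

open Classical in
noncomputable def lam (N : ℕ) (x : ℕ → ZMod 3) : ℕ := if L N x then 24 * (N + 4) else 0

def arm (N : ℕ) (x : ℕ → ZMod 3) : ℕ := if x (N + 1) = x 0 + 1 then 0 else 11 * (N + 4)

def sumw (N : ℕ) (x : ℕ → ZMod 3) : ℕ := ∑ j ∈ Finset.range (N + 1), w N (dd x j) j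

noncomputable def Phi (N : ℕ) (x : ℕ → ZMod 3) : ℕ := sumw N x + arm N x + lam N x

theorem sum_one (m a : ℕ) (g g' : ℕ → ℕ) (ha : a < m) (h : ∀ j, j < m → j ≠ a → g' j = g j) :
    ∑ j ∈ Finset.range m, g' j + g a = ∑ j ∈ Finset.range m, g j + g' a := by
  have h1 := Finset.sum_erase_add (Finset.range m) g (Finset.mem_range.2 ha)
  have h2 := Finset.sum_erase_add (Finset.range m) g' (Finset.mem_range.2 ha)
  have h3 : ∑ j ∈ (Finset.range m).erase a, g' j = ∑ j ∈ (Finset.range m).erase a, g j := by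
    refine Finset.sum_congr rfl fun j hj => ?_
    rw [Finset.mem_erase, Finset.mem_range] at hj
    exact h j hj.2 hj.1
  omega

theorem sum_two (m a b : ℕ) (g g' : ℕ → ℕ) (ha : a < m) (hb : b < m) (hab : a ≠ b)
    (h : ∀ j, j < m → j ≠ a → j ≠ b → g' j = g j) :
    ∑ j ∈ Finset.range m, g' j + g a + g b = ∑ j ∈ Finset.range m, g j + g' a + g' b := by
  have h1 := sum_one m a g (Function.update g a (g' a)) ha
    fun j _ hj => Function.update_of_ne hj _ _
  have h2 := sum_one m b (Function.update g a (g' a)) g' hb (fun j hj hj' => by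
    by_cases e : j = a
    · subst e; simp
    · rw [Function.update_of_ne e]; exact h j hj e hj')
  rw [Function.update_self] at h1
  rw [Function.update_of_ne hab.symm] at h2
  omega

theorem lam_le (N : ℕ) (x : ℕ → ZMod 3) : lam N x ≤ 24 * (N + 4) := by
  unfold lam; split_ifs <;> omega

theorem arm_le (N : ℕ) (x : ℕ → ZMod 3) : arm N x ≤ 11 * (N + 4) := by
  unfold arm; split_ifs <;> omega

theorem lam_mono {N : ℕ} {x x' : ℕ → ZMod 3} (h : L N x' → L N x) : lam N x' ≤ lam N x := by
  unfold lam
  split_ifs with h1 h2 <;> first | omega | exact absurd (h h1) h2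

theorem Phi_lt {N : ℕ} {x x' : ℕ → ZMod 3} {i : ℕ} (h : DStep N x x' i) (hq : ¬ Q N x) :
    Phi N x' < Phi N x := by
  unfold Phi
  cases h with
  | bot h1 h2 h3 =>
    have hs := sum_one (N + 1) 0 (fun j => w N (dd x j) j) (fun j => w N (dd x' j) j) (by omega)
      (fun j _ hj => by simp only [h3 j hj])
    simp only [h1, h2, w1, w2] at hs
    have hl : lam N x = 24 * (N + 4) := if_pos ⟨0, by omega, h1, by omega⟩
    have hl' : lam N x' = 0 := by
      refine if_neg ?_
      rintro ⟨j, hj, h4, h5⟩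
      rcases Nat.eq_zero_or_pos j with e | e
      · subst e; exact n12 (h4.symm.trans h2)
      · exact n20 (h2.symm.trans (h5 0 e))
    have := arm_le N x'
    unfold sumw
    omega
  | mid i hi h1 h2 h3 h4 h5 h6 =>
    have hs := sum_two (N + 1) i (i + 1) (fun j => w N (dd x j) j) (fun j => w N (dd x' j) j)
      (by omega) (by omega) (by omega) (fun j _ hj hj' => by simp only [h4 j hj hj'])
    have ha : arm N x' = arm N x := by simp only [arm, h5, h6]
    have l1 := lam_le N x'
    unfold sumw
    rw [ha]
    rcases zc (dd x i) with e | e | e <;> rcases zc (dd x (i + 1)) with e' | e' | e' <;>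
      simp only [e, e', n12, n10, n20, n10.symm, n20.symm, n12.symm, or_self] at h1 <;>
      simp only [e, e', e12, e21, e22, e11, zero_add] at h2 h3 <;>
      simp only [e, e', h2, h3, w0, w1, w2] at hs
    · -- left arrow moves left
      have := lam_mono (N := N) (x := x) (x' := x') (by
        rintro ⟨j, hj, a1, a2⟩
        by_cases c1 : j < i
        · exact ⟨j, hj, by rw [← h4 j (by omega) (by omega)]; exact a1,
            fun k hk => by rw [← h4 k (by omega) (by omega)]; exact a2 k hk⟩
        · by_cases c2 : j = i
          · subst c2
            refine ⟨j + 1, by omega, e', fun k hk => ?_⟩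
            by_cases c3 : k = j
            · subst c3; exact e
            · rw [← h4 k (by omega) (by omega)]; exact a2 k (by omega)
          · exact absurd (h2.symm.trans (a2 i (by omega))) n10)
      omega
    · -- two left arrows merge
      have := lam_mono (N := N) (x := x) (x' := x') (by
        rintro ⟨j, hj, a1, a2⟩
        by_cases c1 : j < i
        · exact ⟨j, hj, by rw [← h4 j (by omega) (by omega)]; exact a1,
            fun k hk => by rw [← h4 k (by omega) (by omega)]; exact a2 k hk⟩
        · by_cases c2 : j = i
          · subst c2
            exact absurd (a1.symm.trans h2) n12
          · exact absurd (h2.symm.trans (a2 i (by omega))) n20)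
      omega
    · -- right arrow moves right
      have := lam_mono (N := N) (x := x) (x' := x') (by
        rintro ⟨j, hj, a1, a2⟩
        by_cases c1 : j < i
        · exact ⟨j, hj, by rw [← h4 j (by omega) (by omega)]; exact a1,
            fun k hk => by rw [← h4 k (by omega) (by omega)]; exact a2 k hk⟩
        · by_cases c2 : j = i
          · subst c2
            exact absurd (a1.symm.trans h2) n10
          · by_cases c3 : j = i + 1
            · subst c3
              exact absurd (a1.symm.trans h3) n12
            · exact absurd (h3.symm.trans (a2 (i + 1) (by omega))) n20)
      omega
    · omega
    · omega
  | top h1 h2 h3 h4 h5 h6 =>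
    have hs := sum_one (N + 1) N (fun j => w N (dd x j) j) (fun j => w N (dd x' j) j) (by omega)
      (fun j _ hj => by simp only [h4 j (by omega)])
    have a1 : arm N x = 11 * (N + 4) := if_neg h5
    have a2 : arm N x' = 0 := if_pos h6
    obtain ⟨j0, b1, b2⟩ := exists_of_not_Q hq
    have hl := lam_mono (N := N) (x := x) (x' := x') (by
      rintro ⟨j, hj, a1, a2⟩
      have : j < N := by
        by_contra hc
        exact b2 (by rw [← h4 j0 b1]; exact a2 j0 (by omega))
      exact ⟨j, hj, by rw [← h4 j this]; exact a1,
        fun k hk => by rw [← h4 k (by omega)]; exact a2 k hk⟩)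
    unfold sumw
    simp only [h3, w1] at hs
    omega

section Path
variable {N : ℕ} {x : ℕ → ℕ → ZMod 3} {sel : ℕ → ℕ}

theorem eventually_Q (h : ∀ k, DStep N (x k) (x (k + 1)) (sel k)) : ∃ K, ∀ m, K ≤ m → Q N (x m) := by
  have h1 : ∃ K, Q N (x K) := by
    by_contra! hc
    have hb : ∀ k, Phi N (x k) + k ≤ Phi N (x 0) := by
      intro k
      induction k with
      | zero => simp
      | succ k ih => have := Phi_lt (h k) (hc k); omega
    have := hb (Phi N (x 0) + 1)
    omega
  obtain ⟨K, hK⟩ := h1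
  refine ⟨K, fun m hm => ?_⟩
  induction m, hm using Nat.le_induction with
  | base => exact hK
  | succ m _ ih => exact Q_step (h m) ih

theorem go_left (h : ∀ k, DStep N (x k) (x (k + 1)) (sel k)) (j : ℕ) :
    ∀ k, Arr N 1 j (x k) → ∀ i, i ≤ j → ∃ m, k ≤ m ∧ sel m = i ∧ Arr N 1 i (x m) := by
  induction j with
  | zero =>
    intro k hk i hi
    have : i = 0 := by omega
    subst this
    exact ⟨k, le_rfl, (arr1_step (h k) hk).1, hk⟩
  | succ j ih =>
    intro k hk i hi
    by_cases e : i = j + 1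
    · subst e
      exact ⟨k, le_rfl, (arr1_step (h k) hk).1, hk⟩
    · obtain ⟨m, h1, h2⟩ := ih (k + 1) ((arr1_step (h k) hk).2.2 j rfl) i (by omega)
      exact ⟨m, by omega, h2⟩

theorem go_right (h : ∀ k, DStep N (x k) (x (k + 1)) (sel k)) (d : ℕ) :
    ∀ j k, j + d = N → Arr N 2 j (x k) →
      ∃ m, k ≤ m ∧ sel m = N + 1 ∧ Arr N 1 N (x (m + 1)) := by
  induction d with
  | zero =>
    intro j k hj hk
    have h1 := arr2_step (h k) hk
    exact ⟨k, le_rfl, by omega, h1.2.2 (by omega)⟩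
  | succ d ih =>
    intro j k hj hk
    obtain ⟨m, h1, h2⟩ := ih (j + 1) (k + 1) (by omega) ((arr2_step (h k) hk).2.1 (by omega))
    exact ⟨m, by omega, h2⟩

theorem reach_top (h : ∀ k, DStep N (x k) (x (k + 1)) (sel k)) (k : ℕ) (hq : Q N (x k)) :
    ∃ m, k ≤ m ∧ sel m = N + 1 ∧ Arr N 1 N (x (m + 1)) := by
  rcases hq with hq | ⟨j, hq⟩ | ⟨j, hq⟩
  · exact ⟨k, le_rfl, noArr_step (h k) hq⟩
  · obtain ⟨m, h1, h2, h3⟩ := go_left h j k hq 0 (by omega)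
    obtain ⟨m', h4, h5⟩ := go_right h N 0 (m + 1) (by omega) ((arr1_step (h m) h3).2.1 rfl)
    exact ⟨m', by omega, h5⟩
  · exact go_right h (N - j) j k (by have := hq.1; omega) hq

theorem fair (h : ∀ k, DStep N (x k) (x (k + 1)) (sel k)) (i : ℕ) (hi : i ≤ N + 1) (k : ℕ) :
    ∃ m, k ≤ m ∧ sel m = i := by
  obtain ⟨K, hK⟩ := eventually_Q h
  obtain ⟨m, h1, h2, h3⟩ := reach_top h (max k K) (hK _ (by omega))
  by_cases e : i = N + 1
  · exact ⟨m, by omega, by omega⟩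
  · obtain ⟨m', h4, h5, -⟩ := go_left h N (m + 1) h3 i (by omega)
    exact ⟨m', by omega, h5⟩

end Path

/-- Extension of a joint strategy to all natural indices. -/
def ext {n : ℕ} (s : Fin n → ZMod 3) (j : ℕ) : ZMod 3 := if h : j < n then s ⟨j, h⟩ else 0

theorem ext_update {n : ℕ} (s : Fin n → ZMod 3) (i : Fin n) (c : ZMod 3) :
    ext (Function.update s i c) = Function.update (ext s) i.val c := by
  funext j
  by_cases hj : j < n
  · simp [ext, Function.update_apply, hj, Fin.ext_iff]
  · have : j ≠ i.val := by have := i.2; omega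
    simp [ext, hj, this]

theorem ext_val {n : ℕ} (s : Fin n → ZMod 3) (i : Fin n) : ext s i.val = s i := by
  simp [ext]

theorem payoff_ext (N : ℕ) (hN : 1 ≤ N) (s : Fin (N + 2) → ZMod 3) (i : Fin (N + 2)) :
    threePayoff (N + 2) s i =
      if i.val = 0 then (if ext s 0 + 1 = ext s 1 then 0 else 1)
      else if i.val = N + 1 then (if ext s 0 = ext s N ∧ ext s (N + 1) ≠ ext s 0 + 1 then 0 else 1)
      else
        if (ext s i.val + 1 = ext s (i.val - 1) ∨ ext s i.val + 1 = ext s (i.val + 1)) ∧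
           (ext s i.val + 2 = ext s (i.val - 1) ∨ ext s i.val + 2 = ext s (i.val + 1)) then 0
        else if ext s i.val + 1 = ext s (i.val - 1) ∨ ext s i.val + 1 = ext s (i.val + 1) then 1
        else 2 := by
  have e0 : s 0 = ext s 0 := (ext_val s 0).symm
  have e1 : s 1 = ext s 1 := (ext_val s 1).symm
  have ei : s i = ext s i.val := (ext_val s i).symm
  by_cases h0 : i.val = 0
  · have : i = 0 := Fin.ext h0
    simp only [threePayoff, this, e0, e1, if_true, Fin.val_zero]
  have hi0 : i ≠ 0 := fun h => h0 (by simp [h])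
  have em : s (i - 1) = ext s (i.val - 1) := by
    rw [← ext_val s (i - 1)]
    congr 1
    exact Fin.val_sub_one_of_ne_zero hi0
  by_cases h1 : i.val = N + 1
  · have h2 : N + 2 - 1 = N + 1 := by omega
    have h3 : N + 1 - 1 = N := by omega
    simp only [threePayoff, hi0, h0, e0, ei, em, h1, if_true, if_false, h2, h3]
    rfl
  · have ep : s (i + 1) = ext s (i.val + 1) := by
      rw [← ext_val s (i + 1)]
      congr 1
      exact Fin.val_add_one_of_lt' (by have := i.2; omega)
    have h2 : N + 2 - 1 = N + 1 := by omega
    simp only [threePayoff, hi0, h0, e0, ei, em, ep, h1, if_false, h2]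

theorem step_of_lt (N : ℕ) (hN : 1 ≤ N) (s : Fin (N + 2) → ZMod 3) (i : Fin (N + 2))
    (c : ZMod 3) (hlt : threePayoff (N + 2) s i < threePayoff (N + 2) (Function.update s i c) i)
    (h0 : i.val = 0 → c = ext s 0 + 2)
    (hm : 0 < i.val → i.val < N + 1 → c = ext s i.val + 1)
    (ht : i.val = N + 1 → c = ext s 0 + 1) :
    Step N (ext s) (ext (Function.update s i c)) i.val := by
  have hu := ext_update s i c
  rw [payoff_ext N hN, payoff_ext N hN] at hlt
  have hi2 := i.2
  generalize i.val = k at *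
  by_cases k0 : k = 0
  · subst k0
    simp only [if_true] at hlt
    refine .bot ?_ (by rw [hu, h0 rfl])
    by_contra hc
    rw [if_neg hc] at hlt
    split_ifs at hlt <;> omega
  by_cases k1 : k = N + 1
  · subst k1
    simp only [if_true, k0, if_false] at hlt
    have hc : ext s 0 = ext s N ∧ ext s (N + 1) ≠ ext s 0 + 1 := by
      by_contra hc
      rw [if_neg hc] at hlt
      split_ifs at hlt <;> omega
    exact .top hc.1 hc.2 (by rw [hu, ht rfl])
  · obtain ⟨j, rfl⟩ : ∃ j, k = j + 1 := ⟨k - 1, by omega⟩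
    refine .mid j (by omega) ?_ (by rw [hu, hm (by omega) (by omega)])
    by_contra hc
    simp only [k0, k1, if_false, Nat.add_sub_cancel] at hlt
    rw [if_neg (c := (_ ∨ _) ∧ _) (fun h => hc h.1), if_neg hc] at hlt
    split_ifs at hlt <;> omega

end ThreeState

/-- In the three-state game on `n ≥ 3` players, every scheduler `f`
(a function that, at any joint strategy `s` and any player `i` not playing a best
response in `s`, returns a better response `f s i` for `i`) satisfying
`f s 0 = s 0 + 2` (the bottom machine), `f s i = s i + 1` for `0 < i < n - 1`
(the normal machines), and `f s ⟨n-1⟩ = s 0 + 1` (the top machine) ensures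
self-stabilization: in every improvement path generated by `f`, every player is
selected infinitely often and, from a certain point on, every joint strategy in it
is legitimate. -/
theorem three_state_scheduler_self_stabilization
    (n : ℕ) [NeZero n] (hn : 3 ≤ n)
    (f : (Fin n → ZMod 3) → Fin n → ZMod 3)
    (hsched : ∀ (s : Fin n → ZMod 3) (i : Fin n),
      ¬ BestResponse (threePayoff n) s i →
      threePayoff n s i < threePayoff n (Function.update s i (f s i)) i)
    (hf0 : ∀ s : Fin n → ZMod 3, f s 0 = s 0 + 2)
    (hfmid : ∀ (s : Fin n → ZMod 3) (i : Fin n),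
      0 < i.val → i.val < n - 1 → f s i = s i + 1)
    (hftop : ∀ s : Fin n → ZMod 3, f s ⟨n - 1, by omega⟩ = s 0 + 1)
    (σ : ℕ → Fin n → ZMod 3) (sel : ℕ → Fin n)
    (hgen : ∀ k : ℕ,
      ¬ BestResponse (threePayoff n) (σ k) (sel k) ∧
      σ (k + 1) = Function.update (σ k) (sel k) (f (σ k) (sel k))) :
    (∀ (i : Fin n) (k : ℕ), ∃ m, k ≤ m ∧ sel m = i) ∧
    (∃ K : ℕ, ∀ m, K ≤ m → Legitimate (threePayoff n) (σ m)) := by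
  obtain ⟨N, rfl⟩ : ∃ N, n = N + 2 := ⟨n - 2, by omega⟩
  have hN : 1 ≤ N := by omega
  have key : ∀ (s : Fin (N + 2) → ZMod 3) (i : Fin (N + 2)),
      ¬ BestResponse (threePayoff (N + 2)) s i →
      ThreeState.DStep N (ThreeState.ext s)
        (ThreeState.ext (Function.update s i (f s i))) i.val := by
    intro s i hbr
    refine (ThreeState.step_of_lt N hN s i _ (hsched s i hbr) ?_ ?_ ?_).toD hN
    · intro h
      have : i = 0 := Fin.ext h
      subst this
      rw [hf0]; rfl
    · intro h1 h2
      rw [hfmid s i h1 (by omega), ThreeState.ext_val]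
    · intro h
      have : i = ⟨N + 2 - 1, by omega⟩ := Fin.ext h
      rw [this, hftop]; rfl
  have hstep : ∀ k, ThreeState.DStep N (ThreeState.ext (σ k)) (ThreeState.ext (σ (k + 1)))
      (sel k).val := by
    intro k
    rw [(hgen k).2]
    exact key _ _ (hgen k).1
  refine ⟨fun i k => ?_, ?_⟩
  · obtain ⟨m, h1, h2⟩ := ThreeState.fair (x := fun k => ThreeState.ext (σ k))
      (sel := fun k => (sel k).val) hstep i.val (by omega) k
    exact ⟨m, h1, Fin.ext h2⟩
  · obtain ⟨K, hK⟩ := ThreeState.eventually_Q (x := fun k => ThreeState.ext (σ k))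
      (sel := fun k => (sel k).val) hstep
    refine ⟨K, fun m hm => ⟨sel m, (hgen m).1, fun i hi => ?_⟩⟩
    exact Fin.ext (ThreeState.Q_unique (key _ _ hi) (hstep m) (hK m hm))
end
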